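/- Let A ∈ M_{p,q}, let P be any orthogonal matrix with A = P·Diag(λ_1(A),…,λ_n(A))·P^T (eigenvalues nonincreasing), and let α, β, γ be the index sets of positive, zero and negative eigenvalues of A. Let c : ℝ → S^n be differentiable at 0 with c(0) = A and c(t) ∈ M_{p,q} for all t in a neighborhood of 0, and set H := c'(0) (so automatically (P^T H P)_{ββ} = 0). Then t ↦ Π_+(c(t)) is differentiable at 0 and its derivative at 0 equals P·M·P^T, where, writing Ĥ := P^T H P, M is the symmetric matrix with M_{αα} = Ĥ_{αα}, M_{αβ} = Ĥ_{αβ}, M_{ij} = (λ_i(A)/(λ_i(A) − λ_j(A)))·Ĥ_{ij} for i ∈ α, j ∈ γ, and M_{ββ} = 0, M_{βγ} = 0, M_{γγ} = 0. -/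

import Mathlib

open scoped Classical RealInnerProductSpace
open Matrix Set

noncomputable section

abbrev Mat (n : ℕ) : Type := Matrix (Fin n) (Fin n) ℝ

abbrev Em (m : ℕ) : Type := EuclideanSpace ℝ (Fin m)

attribute [instance] Matrix.frobeniusNormedAddCommGroup Matrix.frobeniusNormedSpace

/-- The trace (Frobenius) inner product `⟨A,B⟩ = tr(AᵀB)` on matrices; for symmetric
matrices this is `tr(AB)`. -/
def minner {n : ℕ} (A B : Mat n) : ℝ := (Aᵀ * B).trace

/-- `P` is an orthogonal matrix. -/
def IsOrthoMat {n : ℕ} (P : Mat n) : Prop := P * Pᵀ = 1 ∧ Pᵀ * P = 1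

/-- `(P, lam)` is an eigenvalue decomposition of `A` with orthogonal `P` and
nonincreasing eigenvalue vector `lam`: `A = P·Diag(lam)·Pᵀ`. -/
def IsEigDecomp {n : ℕ} (A P : Mat n) (lam : Fin n → ℝ) : Prop :=
  IsOrthoMat P ∧ Antitone lam ∧ A = P * Matrix.diagonal lam * Pᵀ

/-- The stratum `M_{p,q}` of symmetric matrices with exactly `p` positive and `q` negative
eigenvalues. -/
def stratum (n p q : ℕ) : Set (Mat n) :=
  {A | ∃ P lam, IsEigDecomp A P lam ∧
    {i : Fin n | 0 < lam i}.ncard = p ∧ {i : Fin n | lam i < 0}.ncard = q}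

/-- The metric projection `Π₊` onto the positive semidefinite cone (defined through an
eigenvalue decomposition; the value is independent of the choice of decomposition). -/
noncomputable def piPlus {n : ℕ} (A : Mat n) : Mat n :=
  if h : ∃ P lam, IsEigDecomp A P lam then
    h.choose * Matrix.diagonal (fun i => max (h.choose_spec.choose i) 0) * h.chooseᵀ
  else 0

variable {m n : ℕ}

/-- `G(z) = g(x) + y`. -/
def Gmap (g : Em m → Mat n) (z : Em m × Mat n) : Mat n := g z.1 + z.2

/-- The adjoint `∇g(x) : Sⁿ → ℝᵐ` of the derivative `g'(x)`, characterized by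
`⟨∇g(x)H, v⟩ = ⟨H, g'(x)v⟩`. -/
def gradg (g : Em m → Mat n) (x : Em m) (H : Mat n) : Em m :=
  (EuclideanSpace.equiv (Fin m) ℝ).symm
    fun k => (Hᵀ * fderiv ℝ g x (EuclideanSpace.single k 1)).trace

/-- The Lagrangian `L(x,y) = f(x) + ⟨y, g(x)⟩`. -/
def Lfun (f : Em m → ℝ) (g : Em m → Mat n) (x : Em m) (y : Mat n) : ℝ :=
  f x + minner y (g x)

/-- The Hessian `∇²ₓₓL(x,y)` of `x ↦ L(x,y)`, as a continuous linear map `ℝᵐ → ℝᵐ`. -/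
def hessL (f : Em m → ℝ) (g : Em m → Mat n) (x : Em m) (y : Mat n) : Em m →L[ℝ] Em m :=
  fderiv ℝ (fun u => gradient (fun w => Lfun f g w y) u) x

/-- The KKT mapping `F(z) = (∇f(x) + ∇g(x)y, −g(x) + Π₊(G(z)))`. -/
def KKTF (f : Em m → ℝ) (g : Em m → Mat n) (z : Em m × Mat n) : Em m × Mat n :=
  (gradient f z.1 + gradg g z.1 z.2, - g z.1 + piPlus (Gmap g z))

/-- The lifted stratum `M̃_{p,q} = {z = (x,y) ∈ ℝᵐ × Sⁿ : G(z) ∈ M_{p,q}}`. -/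
def lstratum (g : Em m → Mat n) (p q : ℕ) : Set (Em m × Mat n) :=
  {z | z.2.IsSymm ∧ Gmap g z ∈ stratum n p q}

/-- The norm `‖(u,H)‖ = sqrt(‖u‖² + ‖H‖²)` on `ℝᵐ × Sⁿ` (Frobenius norm on matrices). -/
def pnorm {m n : ℕ} (w : Em m × Mat n) : ℝ := Real.sqrt (‖w.1‖ ^ 2 + ‖w.2‖ ^ 2)

/-- The weak strict Robinson constraint qualification (W-SRCQ) at `z`:
`g'(x)[ℝᵐ] + {PBPᵀ : B ∈ Sⁿ, B_{βγ} = 0, B_{γγ} = 0} = Sⁿ`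
(for any eigenvalue decomposition `(P, lam)` of `G(z)`; independent of the choice). -/
def WSRCQ (g : Em m → Mat n) (z : Em m × Mat n) : Prop :=
  ∀ P lam, IsEigDecomp (Gmap g z) P lam →
    ∀ C : Mat n, C.IsSymm →
      ∃ (v : Em m) (B : Mat n), B.IsSymm ∧
        (∀ i j, lam i = 0 → lam j < 0 → B i j = 0) ∧
        (∀ i j, lam i < 0 → lam j < 0 → B i j = 0) ∧
        C = fderiv ℝ g z.1 v + P * B * Pᵀ

/-- The constraint nondegeneracy at `z`:
`g'(x)[ℝᵐ] + {PBPᵀ : B ∈ Sⁿ, B_{ββ} = 0, B_{βγ} = 0, B_{γγ} = 0} = Sⁿ`. -/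
def CNondeg (g : Em m → Mat n) (z : Em m × Mat n) : Prop :=
  ∀ P lam, IsEigDecomp (Gmap g z) P lam →
    ∀ C : Mat n, C.IsSymm →
      ∃ (v : Em m) (B : Mat n), B.IsSymm ∧
        (∀ i j, lam i = 0 → lam j = 0 → B i j = 0) ∧
        (∀ i j, lam i = 0 → lam j < 0 → B i j = 0) ∧
        (∀ i j, lam i < 0 → lam j < 0 → B i j = 0) ∧
        C = fderiv ℝ g z.1 v + P * B * Pᵀ

/-- The strict Robinson constraint qualification (SRCQ) at a KKT pair `z`:
`g'(x)[ℝᵐ] + {PBPᵀ : B ∈ Sⁿ, B_{ββ} ⪰ 0, B_{βγ} = 0, B_{γγ} = 0} = Sⁿ`. -/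
def SRCQ (g : Em m → Mat n) (z : Em m × Mat n) : Prop :=
  ∀ P lam, IsEigDecomp (Gmap g z) P lam →
    ∀ C : Mat n, C.IsSymm →
      ∃ (v : Em m) (B : Mat n), B.IsSymm ∧
        (∀ u : Fin n → ℝ, (∀ i, lam i ≠ 0 → u i = 0) →
          0 ≤ ∑ i, ∑ j, u i * B i j * u j) ∧
        (∀ i j, lam i = 0 → lam j < 0 → B i j = 0) ∧
        (∀ i j, lam i < 0 → lam j < 0 → B i j = 0) ∧
        C = fderiv ℝ g z.1 v + P * B * Pᵀ

/-- The quadratic form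
`Q(z,v) = ⟨v, ∇²ₓₓL(x,y)v⟩ + 2·Σ_{i∈α}Σ_{j∈γ} (−λⱼ/λᵢ)·([Pᵀ(g'(x)v)P]_{ij})²`. -/
def Qform (f : Em m → ℝ) (g : Em m → Mat n) (z : Em m × Mat n)
    (P : Mat n) (lam : Fin n → ℝ) (v : Em m) : ℝ :=
  ⟪v, hessL f g z.1 z.2 v⟫ +
    2 * ∑ i : Fin n, ∑ j : Fin n,
      (if 0 < lam i ∧ lam j < 0 then
        (-lam j / lam i) * ((Pᵀ * fderiv ℝ g z.1 v * P) i j) ^ 2 else 0)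

/-- `v ∈ appl(z)`: the blocks `ββ`, `βγ`, `γγ` of `Pᵀ(g'(x)v)P` vanish. -/
def memAppl (g : Em m → Mat n) (z : Em m × Mat n)
    (P : Mat n) (lam : Fin n → ℝ) (v : Em m) : Prop :=
  (∀ i j, lam i = 0 → lam j = 0 → (Pᵀ * fderiv ℝ g z.1 v * P) i j = 0) ∧
  (∀ i j, lam i = 0 → lam j < 0 → (Pᵀ * fderiv ℝ g z.1 v * P) i j = 0) ∧
  (∀ i j, lam i < 0 → lam j < 0 → (Pᵀ * fderiv ℝ g z.1 v * P) i j = 0)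

/-- `v ∈ app(z)`: the blocks `βγ`, `γγ` of `Pᵀ(g'(x)v)P` vanish. -/
def memApp (g : Em m → Mat n) (z : Em m × Mat n)
    (P : Mat n) (lam : Fin n → ℝ) (v : Em m) : Prop :=
  (∀ i j, lam i = 0 → lam j < 0 → (Pᵀ * fderiv ℝ g z.1 v * P) i j = 0) ∧
  (∀ i j, lam i < 0 → lam j < 0 → (Pᵀ * fderiv ℝ g z.1 v * P) i j = 0)

/-- The weak second order condition (W-SOC) at `z`: `Q(z,v) ≠ 0` for every nonzero
`v ∈ appl(z)`. -/
def WSOC (f : Em m → ℝ) (g : Em m → Mat n) (z : Em m × Mat n) : Prop :=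
  ∀ P lam, IsEigDecomp (Gmap g z) P lam →
    ∀ v : Em m, v ≠ 0 → memAppl g z P lam v → Qform f g z P lam v ≠ 0

/-- The strong second order sufficient condition (S-SOSC) at `z`: `Q(z,v) > 0` for every
nonzero `v ∈ app(z)`. -/
def SSOSC (f : Em m → ℝ) (g : Em m → Mat n) (z : Em m × Mat n) : Prop :=
  ∀ P lam, IsEigDecomp (Gmap g z) P lam →
    ∀ v : Em m, v ≠ 0 → memApp g z P lam v → 0 < Qform f g z P lam v

/-- The second order necessary condition (SONC) at `z`. -/
def SONC (f : Em m → ℝ) (g : Em m → Mat n) (z : Em m × Mat n) : Prop :=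
  ∀ P lam, IsEigDecomp (Gmap g z) P lam →
    ∀ v : Em m, v ≠ 0 →
      (∀ u : Fin n → ℝ, (∀ i, lam i ≠ 0 → u i = 0) →
        0 ≤ ∑ i, ∑ j, u i * (Pᵀ * fderiv ℝ g z.1 v * P) i j * u j) →
      memApp g z P lam v → 0 ≤ Qform f g z P lam v

/-- The W-SOC holds uniformly on a set `S`: there is `c > 0` with `Q(z,v) ≥ c‖v‖²` for
every `z ∈ S` (in `ℝᵐ × Sⁿ`) and every `v ∈ appl(z)`. -/
def UnifWSOC (f : Em m → ℝ) (g : Em m → Mat n) (S : Set (Em m × Mat n)) : Prop :=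
  ∃ c : ℝ, 0 < c ∧ ∀ z ∈ S, z.2.IsSymm →
    ∀ P lam, IsEigDecomp (Gmap g z) P lam →
      ∀ v : Em m, memAppl g z P lam v → c * ‖v‖ ^ 2 ≤ Qform f g z P lam v

/-- `H ∈ T_z`: `H ∈ Sⁿ` with `(PᵀHP)_{ββ} = 0`. -/
def memTz {n : ℕ} (P : Mat n) (lam : Fin n → ℝ) (H : Mat n) : Prop :=
  H.IsSymm ∧ ∀ i j, lam i = 0 → lam j = 0 → (Pᵀ * H * P) i j = 0

/-- `Δ ∈ N_{G(z)}M_{p,q}`: `Δ ∈ Sⁿ` and `(PᵀΔP)_{ij} = 0` whenever `i ∉ β` or `j ∉ β`. -/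
def memNormal {n : ℕ} (P : Mat n) (lam : Fin n → ℝ) (Δ : Mat n) : Prop :=
  Δ.IsSymm ∧ ∀ i j, (lam i ≠ 0 ∨ lam j ≠ 0) → (Pᵀ * Δ * P) i j = 0

/-- The map `ξ_z : T_z → Sⁿ`, `ξ_z(H) = P·M·Pᵀ`. -/
def xiMap {n : ℕ} (P : Mat n) (lam : Fin n → ℝ) (H : Mat n) : Mat n :=
  P * (Matrix.of fun i j =>
    if 0 < lam i ∧ 0 < lam j then (Pᵀ * H * P) i j
    else if 0 < lam i ∧ lam j = 0 then (Pᵀ * H * P) i j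
    else if lam i = 0 ∧ 0 < lam j then (Pᵀ * H * P) i j
    else if 0 < lam i ∧ lam j < 0 then (lam i / (lam i - lam j)) * (Pᵀ * H * P) i j
    else if lam i < 0 ∧ 0 < lam j then (lam j / (lam j - lam i)) * (Pᵀ * H * P) i j
    else 0) * Pᵀ

/-- The linear map `𝒜_z(v,H) = (∇²ₓₓL(x,y)v − ∇g(x)(g'(x)v) + ∇g(x)H, −g'(x)v + ξ_z(H))`. -/
def Amap (f : Em m → ℝ) (g : Em m → Mat n) (z : Em m × Mat n)
    (P : Mat n) (lam : Fin n → ℝ) (v : Em m) (H : Mat n) : Em m × Mat n :=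
  (hessL f g z.1 z.2 v - gradg g z.1 (fderiv ℝ g z.1 v) + gradg g z.1 H,
    - fderiv ℝ g z.1 v + xiMap P lam H)

/-- The positive inertia index of `A` is `p`. -/
def posInertiaIs {n : ℕ} (A : Mat n) (p : ℕ) : Prop :=
  ∃ P lam, IsEigDecomp A P lam ∧ {i : Fin n | 0 < lam i}.ncard = p

/-- The negative inertia index of `A` is `q`. -/
def negInertiaIs {n : ℕ} (A : Mat n) (q : ℕ) : Prop :=
  ∃ P lam, IsEigDecomp A P lam ∧ {i : Fin n | lam i < 0}.ncard = q

end

open scoped MatrixOrder in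
theorem Matrix.PosSemidef.trace_mul_nonneg_of_real {ι : Type*} [Fintype ι] {S T : Matrix ι ι ℝ}
    (hS : S.PosSemidef) (hT : T.PosSemidef) : 0 ≤ (S * T).trace := by
  classical
  obtain ⟨B, rfl⟩ := CStarAlgebra.nonneg_iff_eq_star_mul_self.mp hT.nonneg
  rw [star_eq_conjTranspose, ← Matrix.mul_assoc, Matrix.trace_mul_comm, ← Matrix.mul_assoc]
  exact (hS.mul_mul_conjTranspose_same B).trace_nonneg

theorem Matrix.PosSemidef.transpose_eq {ι : Type*} {S : Matrix ι ι ℝ}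
    (hS : S.PosSemidef) : Sᵀ = S := by
  simpa using hS.isHermitian.eq

theorem Matrix.trace_mul_self_of_transpose_eq {ι : Type*} [Fintype ι] {D : Matrix ι ι ℝ}
    (hD : Dᵀ = D) : (D * D).trace = ∑ k, ∑ l, D k l ^ 2 := by
  simp only [Matrix.trace, Matrix.diag, Matrix.mul_apply]
  refine Finset.sum_congr rfl fun k _ => Finset.sum_congr rfl fun l _ => ?_
  rw [sq, ← congrFun (congrFun hD k) l, Matrix.transpose_apply]

/-- Nonexpansiveness of the decomposition `X = S - T` into positive and negative parts. -/
theorem sum_sq_posPart_sub_add_le {ι : Type*} [Fintype ι] {S T S' T' : Matrix ι ι ℝ}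
    (hS : S.PosSemidef) (hT : T.PosSemidef) (hS' : S'.PosSemidef) (hT' : T'.PosSemidef)
    (h : S * T = 0) (h' : S' * T' = 0) :
    ∑ k, ∑ l, (S - S') k l ^ 2 + ∑ k, ∑ l, (T - T') k l ^ 2 ≤
      ∑ k, ∑ l, ((S - S') - (T - T')) k l ^ 2 := by
  have hD : (S - S')ᵀ = S - S' := by simp [hS.transpose_eq, hS'.transpose_eq]
  have hE : (T - T')ᵀ = T - T' := by simp [hT.transpose_eq, hT'.transpose_eq]
  rw [← trace_mul_self_of_transpose_eq hD, ← trace_mul_self_of_transpose_eq hE,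
    ← trace_mul_self_of_transpose_eq (by rw [transpose_sub, hD, hE])]
  have h1 := hS.trace_mul_nonneg_of_real hT'
  have h2 := hS'.trace_mul_nonneg_of_real hT
  have h3 : ((S - S') * (T - T')).trace = - (S * T').trace - (S' * T).trace := by
    simp [sub_mul, mul_sub, h, h']
    ring
  have h4 : (((S - S') - (T - T')) * ((S - S') - (T - T'))).trace =
      ((S - S') * (S - S')).trace + ((T - T') * (T - T')).trace
        - 2 * ((S - S') * (T - T')).trace := by
    rw [sub_mul (S - S'), mul_sub (S - S'), mul_sub (T - T'), trace_sub, trace_sub, trace_sub,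
      trace_mul_comm (T - T') (S - S')]
    ring
  linarith

theorem sum_sq_row_le_sum_sq {ι κ : Type*} [Fintype ι] [Fintype κ] (M : Matrix ι κ ℝ) (i : ι) :
    ∑ l, M i l ^ 2 ≤ ∑ k, ∑ l, M k l ^ 2 :=
  Finset.single_le_sum (f := fun k => ∑ l, M k l ^ 2)
    (fun _ _ => Finset.sum_nonneg fun _ _ => sq_nonneg _) (Finset.mem_univ i)

/-- First-order perturbation of the positive part at a diagonal matrix, entrywise. -/
theorem abs_posPart_perturbation_le {ι : Type*} [Fintype ι] [DecidableEq ι]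
    {S T : Matrix ι ι ℝ} {a b : ι → ℝ} (hS : S.PosSemidef) (hT : T.PosSemidef) (h : S * T = 0)
    (ha : 0 ≤ a) (hb : 0 ≤ b) (hab : ∀ i, a i * b i = 0) (i j : ι) :
    |(a i + b j) * (S - diagonal a) i j
        - a i * ((S - diagonal a) - (T - diagonal b)) i j| ≤
      (∑ k, ∑ l, ((S - diagonal a) - (T - diagonal b)) k l ^ 2) / 2 := by
  have ha' : (diagonal a).PosSemidef := posSemidef_diagonal_iff.mpr ha
  have hb' : (diagonal b).PosSemidef := posSemidef_diagonal_iff.mpr hb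
  have hab' : diagonal a * diagonal b = 0 := by
    simp [diagonal_mul_diagonal, hab]
  have key := sum_sq_posPart_sub_add_le hS hT ha' hb' h hab'
  have hE : (T - diagonal b)ᵀ = T - diagonal b := by simp [hT.transpose_eq]
  set D := S - diagonal a with hD_def
  set E := T - diagonal b with hE_def
  have hmul : D * diagonal b + diagonal a * E = - (D * E) := by
    have : S * T = (D + diagonal a) * (E + diagonal b) := by simp [D, E]
    rw [h, add_mul, mul_add, mul_add, hab'] at this
    rw [eq_neg_iff_add_eq_zero, this]
    abel
  have hij : D i j * b j + a i * E i j = - (D * E) i j := by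
    simpa using congrFun (congrFun hmul i) j
  have heq : (a i + b j) * D i j - a i * (D - E) i j = - (D * E) i j := by
    rw [← hij, Matrix.sub_apply]; ring
  rw [heq, abs_neg, mul_apply]
  calc |∑ k, D i k * E k j| ≤ ∑ k, |D i k * E k j| := Finset.abs_sum_le_sum_abs _ _
    _ ≤ ∑ k, (D i k ^ 2 + E j k ^ 2) / 2 := by
        refine Finset.sum_le_sum fun k _ => ?_
        rw [show E k j = E j k from congrFun (congrFun hE j) k, abs_le]
        constructor <;> nlinarith [sq_nonneg (D i k + E j k), sq_nonneg (D i k - E j k)]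
    _ = (∑ k, D i k ^ 2 + ∑ k, E j k ^ 2) / 2 := by
        rw [← Finset.sum_add_distrib, Finset.sum_div]
    _ ≤ _ := by
        have h1 := sum_sq_row_le_sum_sq D i
        have h2 := sum_sq_row_le_sum_sq E j
        linarith

/-- If a positive semidefinite matrix is at least `δ` on a subspace whose dimension is its rank,
then all its nonzero eigenvalues are at least `δ`. -/
theorem Matrix.PosSemidef.mul_dotProduct_mulVec_le {ι : Type*} [Fintype ι] {S : Matrix ι ι ℝ}
    (hS : S.PosSemidef) {δ : ℝ} (hδ : 0 < δ) (V : Submodule ℝ (ι → ℝ))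
    (hV : ∀ x ∈ V, δ * (x ⬝ᵥ x) ≤ x ⬝ᵥ S *ᵥ x) (hr : S.rank ≤ Module.finrank ℝ V) (y : ι → ℝ) :
    δ * (y ⬝ᵥ S *ᵥ y) ≤ (S *ᵥ y) ⬝ᵥ (S *ᵥ y) := by
  have hsymm : ∀ u v : ι → ℝ, u ⬝ᵥ S *ᵥ v = v ⬝ᵥ S *ᵥ u := fun u v => by
    rw [dotProduct_mulVec, ← mulVec_transpose, hS.transpose_eq, dotProduct_comm]
  have hinj : Function.Injective (S.mulVecLin.domRestrict V) := by
    rw [← LinearMap.ker_eq_bot, LinearMap.ker_eq_bot']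
    rintro ⟨x, hx⟩ hx0
    have hx0 : S *ᵥ x = 0 := hx0
    have := hV x hx
    rw [hx0, dotProduct_zero] at this
    have hxx : 0 ≤ x ⬝ᵥ x := Finset.sum_nonneg fun i _ => mul_self_nonneg (x i)
    have : x ⬝ᵥ x = 0 := by nlinarith
    exact Subtype.ext (dotProduct_self_eq_zero.mp this)
  have hrange : LinearMap.range (S.mulVecLin.domRestrict V) = LinearMap.range S.mulVecLin := by
    refine Submodule.eq_of_le_of_finrank_le ?_ ?_
    · rintro _ ⟨x, rfl⟩
      exact ⟨x.1, rfl⟩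
    · rw [LinearMap.finrank_range_of_inj hinj]
      exact hr
  obtain ⟨⟨v, hv⟩, hvy⟩ : S *ᵥ y ∈ LinearMap.range (S.mulVecLin.domRestrict V) := by
    rw [hrange]
    exact ⟨y, rfl⟩
  have hvy : S *ᵥ v = S *ᵥ y := hvy
  have hquad : y ⬝ᵥ S *ᵥ y = v ⬝ᵥ S *ᵥ v := by
    rw [← hvy, hsymm, ← hvy]
  rw [hquad, ← hvy]
  have hcs : (v ⬝ᵥ S *ᵥ v) ^ 2 ≤ (v ⬝ᵥ v) * (S *ᵥ v ⬝ᵥ S *ᵥ v) := by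
    simpa [dotProduct, sq] using Finset.sum_mul_sq_le_sq_mul_sq Finset.univ v (S *ᵥ v)
  have hv' := hV v hv
  have hnn : 0 ≤ v ⬝ᵥ S *ᵥ v := by simpa using hS.dotProduct_mulVec_nonneg v
  have hww : 0 ≤ S *ᵥ v ⬝ᵥ S *ᵥ v := Finset.sum_nonneg fun i _ => mul_self_nonneg _
  rcases hnn.eq_or_lt with h0 | hpos
  · rw [← h0, mul_zero]; exact hww
  · refine le_of_mul_le_mul_right ?_ hpos
    calc δ * (v ⬝ᵥ S *ᵥ v) * (v ⬝ᵥ S *ᵥ v) = δ * (v ⬝ᵥ S *ᵥ v) ^ 2 := by ring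
      _ ≤ δ * ((v ⬝ᵥ v) * (S *ᵥ v ⬝ᵥ S *ᵥ v)) := by gcongr
      _ = (δ * (v ⬝ᵥ v)) * (S *ᵥ v ⬝ᵥ S *ᵥ v) := by ring
      _ ≤ (v ⬝ᵥ S *ᵥ v) * (S *ᵥ v ⬝ᵥ S *ᵥ v) := by gcongr
      _ = _ := mul_comm _ _

theorem Matrix.PosSemidef.two_mul_abs_apply_le {ι : Type*} [Fintype ι] [DecidableEq ι]
    {S : Matrix ι ι ℝ} (hS : S.PosSemidef) (i j : ι) : 2 * |S i j| ≤ S i i + S j j := by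
  have h1 := hS.dotProduct_mulVec_nonneg (Pi.single i 1 + Pi.single j 1)
  have h2 := hS.dotProduct_mulVec_nonneg (Pi.single i 1 - Pi.single j 1)
  have hij : S j i = S i j := congrFun (congrFun hS.transpose_eq i) j
  simp [mulVec_add, mulVec_sub, add_dotProduct, sub_dotProduct] at h1 h2
  rw [hij] at h1 h2
  have : |S i j| ≤ (S i i + S j j) / 2 := abs_le.mpr ⟨by linarith, by linarith⟩
  linarith

theorem abs_dotProduct_mulVec_le {ι : Type*} [Fintype ι] (D : Matrix ι ι ℝ) {ε : ℝ} (hε : 0 ≤ ε)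
    (hD : ∑ k, ∑ l, D k l ^ 2 ≤ ε ^ 2) (x : ι → ℝ) : |x ⬝ᵥ D *ᵥ x| ≤ ε * (x ⬝ᵥ x) := by
  have hxx : 0 ≤ x ⬝ᵥ x := Finset.sum_nonneg fun i _ => mul_self_nonneg (x i)
  have h1 : (x ⬝ᵥ D *ᵥ x) ^ 2 ≤ (x ⬝ᵥ x) * (D *ᵥ x ⬝ᵥ D *ᵥ x) := by
    simpa [dotProduct, sq] using Finset.sum_mul_sq_le_sq_mul_sq Finset.univ x (D *ᵥ x)
  have h2 : D *ᵥ x ⬝ᵥ D *ᵥ x ≤ (∑ k, ∑ l, D k l ^ 2) * (x ⬝ᵥ x) := by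
    rw [Finset.sum_mul]
    refine Finset.sum_le_sum fun k _ => ?_
    simpa [dotProduct, mulVec, sq] using Finset.sum_mul_sq_le_sq_mul_sq Finset.univ (D k) x
  refine abs_le_of_sq_le_sq ?_ (mul_nonneg hε hxx)
  calc (x ⬝ᵥ D *ᵥ x) ^ 2 ≤ (x ⬝ᵥ x) * (ε ^ 2 * (x ⬝ᵥ x)) :=
        h1.trans (mul_le_mul_of_nonneg_left
          (h2.trans (mul_le_mul_of_nonneg_right hD hxx)) hxx)
    _ = (ε * (x ⬝ᵥ x)) ^ 2 := by ring

/-- Near a positive semidefinite diagonal matrix of the same rank, the block on the kernel of the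
diagonal matrix is of second order. -/
theorem abs_apply_le_of_rank_le {ι : Type*} [Fintype ι] [DecidableEq ι] {S : Matrix ι ι ℝ}
    (hS : S.PosSemidef) {a : ι → ℝ} {δ κ : ℝ} (hδ : 0 < δ) (haδ : ∀ i, a i ≠ 0 → 2 * δ ≤ a i)
    (hr : S.rank ≤ Fintype.card {i // a i ≠ 0})
    (hκ : ∑ k, ∑ l, (S - diagonal a) k l ^ 2 ≤ κ) (hκδ : κ ≤ δ ^ 2)
    {i j : ι} (hi : a i = 0) (hj : a j = 0) : |S i j| ≤ κ / δ := by
  let f : ({i // a i ≠ 0} → ℝ) →ₗ[ℝ] (ι → ℝ) :=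
    Function.ExtendByZero.linearMap ℝ (Subtype.val : {i // a i ≠ 0} → ι)
  have hf : Function.Injective f := Function.extend_injective Subtype.val_injective _
  have hf0 : ∀ v k, a k = 0 → f v k = 0 := fun v k hk => by
    refine Function.extend_apply' _ _ _ ?_
    rintro ⟨⟨l, hl⟩, rfl⟩
    exact hl hk
  have hdiag : ∀ k, a k = 0 → S k k ≤ κ / δ := by
    intro k hk
    have hgap := hS.mul_dotProduct_mulVec_le hδ (LinearMap.range f) (by
      rintro _ ⟨v, rfl⟩
      have h1 := abs_le.mp (abs_dotProduct_mulVec_le (S - diagonal a) hδ.le (hκ.trans hκδ) (f v))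
      rw [sub_mulVec, dotProduct_sub] at h1
      have h2 : 2 * δ * (f v ⬝ᵥ f v) ≤ f v ⬝ᵥ diagonal a *ᵥ f v := by
        simp only [dotProduct, mulVec_diagonal, Finset.mul_sum]
        refine Finset.sum_le_sum fun l _ => ?_
        by_cases hl : a l = 0
        · simp [hf0 v l hl]
        · nlinarith [haδ l hl, mul_self_nonneg (f v l)]
      linarith [h1.1]) (by
      rw [LinearMap.finrank_range_of_inj hf]
      simpa using hr) (Pi.single k 1)
    have hrow : (S *ᵥ Pi.single k 1) ⬝ᵥ (S *ᵥ Pi.single k 1) ≤ κ := by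
      refine le_trans (le_of_eq ?_) ((sum_sq_row_le_sum_sq (S - diagonal a) k).trans hκ)
      simp only [dotProduct, mulVec_single_one, sq]
      refine Finset.sum_congr rfl fun l _ => ?_
      have h1 : (S - diagonal a) k l = S k l := by
        by_cases hkl : k = l
        · subst hkl; simp [hk]
        · simp [hkl]
      rw [h1, show S k l = S l k from congrFun (congrFun hS.transpose_eq l) k]
      rfl
    rw [le_div_iff₀ hδ, mul_comm]
    refine le_trans ?_ (hgap.trans hrow)
    simp
  linarith [hS.two_mul_abs_apply_le i j, hdiag i hi, hdiag j hj]

/-- Independence of the functional calculus from the chosen eigenvalue decomposition. -/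
theorem orthogonal_diagonal_comp_eq {n : ℕ} {P Q : Mat n} {l m : Fin n → ℝ}
    (hP : IsOrthoMat P) (hQ : IsOrthoMat Q)
    (h : P * diagonal l * Pᵀ = Q * diagonal m * Qᵀ) (f : ℝ → ℝ) :
    P * diagonal (f ∘ l) * Pᵀ = Q * diagonal (f ∘ m) * Qᵀ := by
  have hconj : ∀ d e : Fin n → ℝ, P * diagonal d * Pᵀ = Q * diagonal e * Qᵀ ↔
      Qᵀ * P * diagonal d = diagonal e * (Qᵀ * P) := fun d e => by
    constructor
    · intro h
      calc Qᵀ * P * diagonal d = Qᵀ * (P * diagonal d * Pᵀ) * P := by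
            simp only [Matrix.mul_assoc, hP.2, Matrix.mul_one]
        _ = (Qᵀ * Q) * diagonal e * (Qᵀ * P) := by
            rw [h]; simp only [Matrix.mul_assoc]
        _ = _ := by rw [hQ.2, Matrix.one_mul]
    · intro h
      calc P * diagonal d * Pᵀ = (Q * Qᵀ) * P * diagonal d * Pᵀ := by
            rw [hQ.1, Matrix.one_mul]
        _ = Q * (Qᵀ * P * diagonal d) * Pᵀ := by simp only [Matrix.mul_assoc]
        _ = Q * diagonal e * Qᵀ * (P * Pᵀ) := by
            rw [h]; simp only [Matrix.mul_assoc]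
        _ = _ := by rw [hP.1, Matrix.mul_one]
  rw [hconj] at h ⊢
  ext i j
  have hij := congrFun (congrFun h i) j
  rw [mul_diagonal, diagonal_mul] at hij ⊢
  by_cases hlm : l j = m i
  · simp [hlm, mul_comm]
  · have : (Qᵀ * P) i j = 0 := by
      have : (Qᵀ * P) i j * (l j - m i) = 0 := by linarith
      exact (mul_eq_zero.mp this).resolve_right (sub_ne_zero.mpr hlm)
    simp [this]

theorem IsEigDecomp.piPlus_eq {n : ℕ} {A P : Mat n} {lam : Fin n → ℝ}
    (h : IsEigDecomp A P lam) : piPlus A = P * diagonal (fun i => max (lam i) 0) * Pᵀ := by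
  have hex : ∃ P lam, IsEigDecomp A P lam := ⟨P, lam, h⟩
  have hspec := hex.choose_spec.choose_spec
  rw [piPlus, dif_pos hex]
  exact orthogonal_diagonal_comp_eq hspec.1 h.1 (hspec.2.2.symm.trans h.2.2) fun x => max x 0

theorem IsOrthoMat.isUnit_det {n : ℕ} {P : Mat n} (hP : IsOrthoMat P) : IsUnit P.det :=
  isUnit_det_of_right_inverse hP.1

theorem IsOrthoMat.isUnit_det_transpose {n : ℕ} {P : Mat n} (hP : IsOrthoMat P) :
    IsUnit Pᵀ.det :=
  isUnit_det_of_right_inverse hP.2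

theorem IsEigDecomp.rank_piPlus {n : ℕ} {A P : Mat n} {lam : Fin n → ℝ}
    (h : IsEigDecomp A P lam) : (piPlus A).rank = Fintype.card {i // max (lam i) 0 ≠ 0} := by
  rw [h.piPlus_eq, rank_mul_eq_left_of_isUnit_det _ _ h.1.isUnit_det_transpose,
    rank_mul_eq_right_of_isUnit_det _ _ h.1.isUnit_det, rank_diagonal]

theorem rank_piPlus_of_mem_stratum {n p q : ℕ} {A : Mat n} (hA : A ∈ stratum n p q) :
    (piPlus A).rank = p := by
  obtain ⟨P, lam, h, hp, -⟩ := hA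
  rw [h.rank_piPlus, ← hp, ← Nat.card_coe_set_eq, Nat.card_eq_fintype_card]
  refine Fintype.card_congr (Equiv.subtypeEquivRight fun i => ?_)
  simp

theorem IsEigDecomp.posSemidef_piPlus {n : ℕ} {A P : Mat n} {lam : Fin n → ℝ}
    (h : IsEigDecomp A P lam) : (piPlus A).PosSemidef := by
  rw [h.piPlus_eq]
  exact (posSemidef_diagonal_iff.mpr fun i => le_max_right _ _).mul_mul_conjTranspose_same P

theorem IsEigDecomp.piPlus_sub_eq {n : ℕ} {A P : Mat n} {lam : Fin n → ℝ}
    (h : IsEigDecomp A P lam) :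
    piPlus A - A = P * diagonal (fun i => max (-lam i) 0) * Pᵀ := by
  conv_lhs => rw [h.piPlus_eq, h.2.2]
  rw [← sub_mul, ← mul_sub, diagonal_sub]
  congr 3
  ext i
  rcases le_total (lam i) 0 with hi | hi <;> simp [hi]

theorem IsEigDecomp.posSemidef_piPlus_sub {n : ℕ} {A P : Mat n} {lam : Fin n → ℝ}
    (h : IsEigDecomp A P lam) : (piPlus A - A).PosSemidef := by
  rw [h.piPlus_sub_eq]
  exact (posSemidef_diagonal_iff.mpr fun i => le_max_right _ _).mul_mul_conjTranspose_same P

theorem max_mul_max_neg_eq_zero (x : ℝ) : max x 0 * max (-x) 0 = 0 := by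
  rcases le_total x 0 with hx | hx <;> simp [hx]

theorem IsEigDecomp.piPlus_mul_piPlus_sub {n : ℕ} {A P : Mat n} {lam : Fin n → ℝ}
    (h : IsEigDecomp A P lam) : piPlus A * (piPlus A - A) = 0 := by
  rw [h.piPlus_sub_eq, h.piPlus_eq]
  calc _ = P * (diagonal (fun i => max (lam i) 0) * (Pᵀ * P) *
        diagonal (fun i => max (-lam i) 0)) * Pᵀ := by simp only [Matrix.mul_assoc]
    _ = 0 := by simp [h.1.2, diagonal_mul_diagonal, max_mul_max_neg_eq_zero]

theorem hasDerivAt_mat_iff {n : ℕ} {f : ℝ → Mat n} {f' : Mat n} {x : ℝ} :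
    HasDerivAt f f' x ↔ ∀ i j, HasDerivAt (fun t => f t i j) (f' i j) x := by
  constructor
  · intro h i j
    exact (LinearMap.toContinuousLinearMap
      (Matrix.entryLinearMap ℝ ℝ i j : Mat n →ₗ[ℝ] ℝ)).hasFDerivAt.comp_hasDerivAt x h
  · intro h
    have hsum : ∀ M : Mat n, M = ∑ i, ∑ j, M i j • Matrix.single i j (1 : ℝ) := fun M => by
      simpa [Matrix.smul_single] using Matrix.matrix_eq_sum_single M
    have : HasDerivAt (fun t => ∑ i, ∑ j, f t i j • (Matrix.single i j (1 : ℝ) : Mat n))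
        (∑ i, ∑ j, f' i j • (Matrix.single i j (1 : ℝ) : Mat n)) x :=
      HasDerivAt.fun_sum fun i _ => HasDerivAt.fun_sum fun j _ => (h i j).smul_const _
    rw [← hsum f'] at this
    exact this.congr_of_eventuallyEq (Filter.Eventually.of_forall fun t => hsum (f t))

theorem HasDerivAt.mat_mul_mul {n : ℕ} {f : ℝ → Mat n} {f' : Mat n} {x : ℝ}
    (h : HasDerivAt f f' x) (L R : Mat n) :
    HasDerivAt (fun t => L * f t * R) (L * f' * R) x :=
  (LinearMap.toContinuousLinearMap
    (LinearMap.mulLeftRight ℝ (L, R) : Mat n →ₗ[ℝ] Mat n)).hasFDerivAt.comp_hasDerivAt x h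

theorem hasDerivAt_of_abs_sub_mul_le {g k κ : ℝ → ℝ} {m k' C : ℝ}
    (hk : HasDerivAt k k' 0) (hκ : HasDerivAt κ 0 0) (hκ0 : κ 0 = 0) (hg0 : g 0 = m * k 0)
    (h : ∀ᶠ t in nhds 0, |g t - m * k t| ≤ C * κ t) : HasDerivAt g (m * k') 0 := by
  have hr : HasDerivAt (fun t => g t - m * k t) 0 0 := by
    rw [hasDerivAt_iff_isLittleO] at hκ ⊢
    simp only [hg0, hκ0, sub_self, sub_zero, smul_zero] at hκ ⊢
    refine Asymptotics.IsBigO.trans_isLittleO (Asymptotics.IsBigO.of_bound |C| ?_) hκ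
    filter_upwards [h] with t ht
    rw [Real.norm_eq_abs, Real.norm_eq_abs, ← abs_mul]
    exact ht.trans (le_abs_self _)
  simpa using hr.fun_add (hk.const_mul m)

/-- Differential of `Π₊` along a curve in the stratum `M_{p,q}`. -/
theorem piPlus_deriv_on_stratum {n p q : ℕ} (A P : Mat n) (lam : Fin n → ℝ)
    (hA : A ∈ stratum n p q)
    (hdec : IsEigDecomp A P lam)
    (c : ℝ → Mat n) (H : Mat n)
    (hc0 : c 0 = A)
    (hcM : ∀ᶠ t in nhds (0 : ℝ), c t ∈ stratum n p q)
    (hder : HasDerivAt c H 0) :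
    HasDerivAt (fun t => piPlus (c t))
      (P * (Matrix.of fun i j =>
        if 0 < lam i ∧ 0 < lam j then (Pᵀ * H * P) i j
        else if 0 < lam i ∧ lam j = 0 then (Pᵀ * H * P) i j
        else if lam i = 0 ∧ 0 < lam j then (Pᵀ * H * P) i j
        else if 0 < lam i ∧ lam j < 0 then (lam i / (lam i - lam j)) * ((Pᵀ * H * P) i j)
        else if lam i < 0 ∧ 0 < lam j then (lam j / (lam j - lam i)) * ((Pᵀ * H * P) i j)
        else 0) * Pᵀ) 0 := by
  have hP := hdec.1
  have hS0 : Pᵀ * piPlus (c 0) * P = diagonal fun i => max (lam i) 0 := by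
    rw [hc0, hdec.piPlus_eq]
    calc _ = (Pᵀ * P) * (diagonal fun i => max (lam i) 0) * (Pᵀ * P) := by
          simp only [Matrix.mul_assoc]
      _ = _ := by simp [hP.2]
  have hT0 : Pᵀ * (piPlus (c 0) - c 0) * P = diagonal fun i => max (-lam i) 0 := by
    rw [hc0, hdec.piPlus_sub_eq]
    calc _ = (Pᵀ * P) * (diagonal fun i => max (-lam i) 0) * (Pᵀ * P) := by
          simp only [Matrix.mul_assoc]
      _ = _ := by simp [hP.2]
  have hback : (fun t => piPlus (c t)) = fun t => P * (Pᵀ * piPlus (c t) * P) * Pᵀ := by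
    funext t
    calc piPlus (c t) = (P * Pᵀ) * piPlus (c t) * (P * Pᵀ) := by simp [hP.1]
      _ = _ := by simp only [Matrix.mul_assoc]
  rw [hback]
  refine HasDerivAt.mat_mul_mul ?_ _ _
  let a : Fin n → ℝ := fun i => max (lam i) 0
  let b : Fin n → ℝ := fun i => max (-lam i) 0
  let S : ℝ → Mat n := fun t => Pᵀ * piPlus (c t) * P
  let T : ℝ → Mat n := fun t => Pᵀ * (piPlus (c t) - c t) * P
  let K : ℝ → Mat n := fun t => (S t - diagonal a) - (T t - diagonal b)
  let κ : ℝ → ℝ := fun t => ∑ k, ∑ l, K t k l ^ 2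
  have hK0 : K 0 = 0 := by
    simp only [K, S, T, hS0, hT0, a, b, sub_self]
  have hK : ∀ i j, HasDerivAt (fun t => K t i j) ((Pᵀ * H * P) i j) 0 := by
    refine hasDerivAt_mat_iff.mp ?_
    have hKc : K = fun t => Pᵀ * c t * P - (diagonal a - diagonal b) := by
      funext t
      simp only [K, S, T, mul_sub, sub_mul]
      abel
    rw [hKc]
    exact (hder.mat_mul_mul Pᵀ P).sub_const _
  have hκ0 : κ 0 = 0 := by simp [κ, hK0]
  have hκ : HasDerivAt κ 0 0 := by
    have : HasDerivAt κ (∑ k, ∑ l, (2 : ℕ) * K 0 k l ^ (2 - 1) * (Pᵀ * H * P) k l) 0 :=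
      HasDerivAt.fun_sum fun k _ => HasDerivAt.fun_sum fun l _ => (hK k l).fun_pow 2
    simpa [hK0] using this
  have hprops : ∀ᶠ t in nhds (0 : ℝ), (S t).PosSemidef ∧ (T t).PosSemidef ∧ S t * T t = 0 ∧
      (S t).rank ≤ Fintype.card {i // a i ≠ 0} := by
    filter_upwards [hcM] with t ht
    have hrank : (S t).rank = (piPlus A).rank := by
      rw [rank_piPlus_of_mem_stratum hA, ← rank_piPlus_of_mem_stratum ht,
        rank_mul_eq_left_of_isUnit_det _ _ hP.isUnit_det,
        rank_mul_eq_right_of_isUnit_det _ _ hP.isUnit_det_transpose]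
    obtain ⟨Q, mu, hQ, -⟩ := ht
    refine ⟨hQ.posSemidef_piPlus.conjTranspose_mul_mul_same P,
      hQ.posSemidef_piPlus_sub.conjTranspose_mul_mul_same P, ?_,
      (hrank.trans hdec.rank_piPlus).le⟩
    calc S t * T t = Pᵀ * (piPlus (c t) * (P * Pᵀ) * (piPlus (c t) - c t)) * P := by
          simp only [S, T, Matrix.mul_assoc]
      _ = 0 := by simp [hP.1, hQ.piPlus_mul_piPlus_sub]
  have ha : 0 ≤ a := fun i => le_max_right _ _
  have hb : 0 ≤ b := fun i => le_max_right _ _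
  have hab : ∀ i, a i * b i = 0 := fun i => max_mul_max_neg_eq_zero (lam i)
  have key : ∀ i j, 0 < a i + b j → ∀ᶠ t in nhds (0 : ℝ),
      |(S t - diagonal a) i j - a i / (a i + b j) * K t i j| ≤ 1 / (2 * (a i + b j)) * κ t := by
    intro i j hij
    filter_upwards [hprops] with t ht
    have h1 := abs_posPart_perturbation_le ht.1 ht.2.1 ht.2.2.1 ha hb hab i j
    have h2 : (S t - diagonal a) i j - a i / (a i + b j) * K t i j =
        ((a i + b j) * (S t - diagonal a) i j - a i * K t i j) / (a i + b j) := by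
      field_simp
    rw [h2, abs_div, abs_of_pos hij, div_le_iff₀ hij]
    refine h1.trans (le_of_eq ?_)
    field_simp
    rfl
  have hD : ∀ i j (m C : ℝ), (∀ᶠ t in nhds (0 : ℝ),
      |(S t - diagonal a) i j - m * K t i j| ≤ C * κ t) →
      HasDerivAt (fun t => S t i j) (m * (Pᵀ * H * P) i j) 0 := by
    intro i j m C h
    have h1 : HasDerivAt (fun t => (S t - diagonal a) i j) (m * (Pᵀ * H * P) i j) 0 := by
      refine hasDerivAt_of_abs_sub_mul_le (hK i j) hκ hκ0 ?_ h
      rw [hK0]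
      simp [S, hS0, a]
    simpa using h1.add_const (diagonal a i j)
  have hmain : ∀ i j, 0 < a i + b j →
      HasDerivAt (fun t => S t i j) (a i / (a i + b j) * (Pᵀ * H * P) i j) 0 :=
    fun i j hij => hD i j _ _ (key i j hij)
  have hHsymm : ∀ i j, (Pᵀ * H * P) i j = (Pᵀ * H * P) j i := by
    intro i j
    refine (hK i j).unique ((hK j i).congr_of_eventuallyEq ?_)
    filter_upwards [hprops] with t ht
    have hKt : (K t)ᵀ = K t := by simp [K, ht.1.transpose_eq, ht.2.1.transpose_eq]
    exact congrFun (congrFun hKt j) i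
  have hmain' : ∀ i j, 0 < a j + b i →
      HasDerivAt (fun t => S t i j) (a j / (a j + b i) * (Pᵀ * H * P) i j) 0 := by
    intro i j hij
    rw [hHsymm]
    refine (hmain j i hij).congr_of_eventuallyEq ?_
    filter_upwards [hprops] with t ht
    exact congrFun (congrFun ht.1.transpose_eq j) i
  have hzero : ∀ i j, a i = 0 → a j = 0 → HasDerivAt (fun t => S t i j) 0 0 := by
    intro i j hi hj
    obtain ⟨δ, hδ, haδ⟩ : ∃ δ : ℝ, 0 < δ ∧ ∀ k, a k ≠ 0 → 2 * δ ≤ a k := by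
      have hev : ∀ᶠ δ in nhdsWithin (0 : ℝ) (Ioi 0), ∀ k, a k ≠ 0 → 2 * δ ≤ a k := by
        refine Filter.eventually_all.mpr fun k => ?_
        by_cases hk : a k = 0
        · simp [hk]
        · have hpos : 0 < a k := lt_of_le_of_ne (ha k) (Ne.symm hk)
          filter_upwards [nhdsWithin_le_nhds (Iio_mem_nhds (half_pos hpos))] with δ hδ _
          linarith [show δ < a k / 2 from hδ]
      obtain ⟨δ, h1, h2⟩ := (hev.and self_mem_nhdsWithin).exists
      exact ⟨δ, h2, h1⟩
    have := hD i j 0 (1 / δ) (by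
      have hsmall : ∀ᶠ t in nhds (0 : ℝ), κ t < δ ^ 2 :=
        hκ.continuousAt.eventually_lt_const (by rw [hκ0]; positivity)
      filter_upwards [hprops, hsmall] with t ht hts
      have ha' : (diagonal a).PosSemidef := posSemidef_diagonal_iff.mpr ha
      have hb' : (diagonal b).PosSemidef := posSemidef_diagonal_iff.mpr hb
      have hS_le := sum_sq_posPart_sub_add_le ht.1 ht.2.1 ha' hb' ht.2.2.1
        (by simp [diagonal_mul_diagonal, hab])
      have hT_nonneg : 0 ≤ ∑ k, ∑ l, (T t - diagonal b) k l ^ 2 :=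
        Finset.sum_nonneg fun _ _ => Finset.sum_nonneg fun _ _ => sq_nonneg _
      have h1 := abs_apply_le_of_rank_le ht.1 hδ haδ ht.2.2.2
        (show _ ≤ κ t by linarith) hts.le hi hj
      have h2 : diagonal a i j = 0 := by
        by_cases hij : i = j
        · subst hij; simp [hi]
        · simp [hij]
      rw [Matrix.sub_apply, h2, zero_mul, sub_zero, sub_zero]
      exact h1.trans (le_of_eq (by ring)))
    simpa using this
  refine hasDerivAt_mat_iff.mpr fun i j => ?_
  show HasDerivAt (fun t => S t i j) _ 0
  have ha_pos : ∀ k, 0 < lam k → a k = lam k ∧ b k = 0 := fun k hk =>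
    ⟨max_eq_left hk.le, max_eq_right (by linarith)⟩
  have ha_neg : ∀ k, lam k ≤ 0 → a k = 0 ∧ b k = -lam k := fun k hk =>
    ⟨max_eq_right hk, max_eq_left (by linarith)⟩
  rw [Matrix.of_apply]
  rcases lt_or_ge 0 (lam i) with hi | hi
  · obtain ⟨hai, hbi⟩ := ha_pos i hi
    have hij : 0 < a i + b j := by have := hb j; simp only [Pi.zero_apply] at this; linarith
    convert hmain i j hij using 1
    rcases lt_trichotomy 0 (lam j) with hj | hj | hj
    · simp [hai, (ha_pos j hj).2, hi, hj, hi.ne']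
    · simp [hai, (ha_neg j hj.ge).2, hi, ← hj, hi.ne']
    · simp [hai, (ha_neg j hj.le).2, hi, hj, hj.ne, hj.not_gt, hi.ne', sub_eq_add_neg]
  · obtain ⟨hai, hbi⟩ := ha_neg i hi
    rcases lt_or_ge 0 (lam j) with hj | hj
    · obtain ⟨haj, hbj⟩ := ha_pos j hj
      convert hmain' i j (by linarith) using 1
      rcases hi.lt_or_eq with hi' | hi'
      · simp [haj, hbi, hi', hj, hi'.ne, hi'.not_gt, sub_eq_add_neg]
      · simp [haj, hbi, hi', hj, hj.ne']
    · convert hzero i j hai (ha_neg j hj).1 using 1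
      simp [hi.not_gt, hj.not_gt]
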